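/- Theorem (Theorem 5.3, crossing-symmetric φ³ amplitude from deformed associahedra): Let n ≥ 3, and let s : Finset (Fin n) → ℝ be any function with s I ≠ 0 for every split I. For a permutation σ of Fin n set M_n(σ) := Σ_{T a triangulation} Π_{(i,j) ∈ T} (s(σ • arc(i,j)))⁻¹, and let the φ³ amplitude be M := Σ_{C a scattering channel} Π_{I ∈ C} (s I)⁻¹. Then Σ_{σ ∈ Perm(Fin n)} M_n(σ) = n · 2^{n−2} · M; consequently, for every finite set R of permutations of Fin n containing exactly one element of each coset σ·D of the dihedral subgroup D, one has Σ_{σ ∈ R} M_n(σ) = 2^{n−3} · M. -/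

import Mathlib

open scoped Classical

/-- Normalization of a subset of `Fin n`: itself if it contains `0`, else its complement. -/
def normSet {n : ℕ} [NeZero n] (J : Finset (Fin n)) : Finset (Fin n) :=
  if (0 : Fin n) ∈ J then J else Jᶜ

/-- A split: a subset containing 0 with `2 ≤ |I| ≤ n - 2`. -/
def IsSplit {n : ℕ} [NeZero n] (I : Finset (Fin n)) : Prop :=
  (0 : Fin n) ∈ I ∧ 2 ≤ I.card ∧ I.card ≤ n - 2

/-- Action of a permutation on a subset, followed by normalization. -/
def actSet {n : ℕ} [NeZero n] (σ : Equiv.Perm (Fin n)) (J : Finset (Fin n)) : Finset (Fin n) :=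
  normSet (J.image σ)

/-- Compatibility of two splits. -/
def Compatible {n : ℕ} (I J : Finset (Fin n)) : Prop :=
  I ⊆ J ∨ J ⊆ I ∨ I ∪ J = Finset.univ

/-- A scattering channel: `n - 3` pairwise compatible splits. -/
def IsChannel {n : ℕ} [NeZero n] (C : Finset (Finset (Fin n))) : Prop :=
  C.card = n - 3 ∧ (∀ I ∈ C, IsSplit I) ∧ ∀ I ∈ C, ∀ J ∈ C, I ≠ J → Compatible I J

/-- A diagonal of the `n`-gon: a pair `(i, j)` with `i + 2 ≤ j` and `(i,j) ≠ (0, n-1)`. -/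
def IsDiagonal {n : ℕ} (d : Fin n × Fin n) : Prop :=
  d.1.val + 2 ≤ d.2.val ∧ ¬(d.1.val = 0 ∧ d.2.val = n - 1)

/-- Two diagonals cross. -/
def Cross {n : ℕ} (d e : Fin n × Fin n) : Prop :=
  (d.1 < e.1 ∧ e.1 < d.2 ∧ d.2 < e.2) ∨ (e.1 < d.1 ∧ d.1 < e.2 ∧ e.2 < d.2)

/-- A triangulation: `n - 3` pairwise noncrossing diagonals. -/
def IsTriangulation {n : ℕ} (T : Finset (Fin n × Fin n)) : Prop :=
  T.card = n - 3 ∧ (∀ d ∈ T, IsDiagonal d) ∧ ∀ d ∈ T, ∀ e ∈ T, d ≠ e → ¬ Cross d e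

/-- The arc of a diagonal `(i, j)`: the subset `{i, i+1, …, j-1}` of `Fin n`. -/
def arcOf {n : ℕ} (d : Fin n × Fin n) : Finset (Fin n) :=
  Finset.univ.filter (fun k => d.1.val ≤ k.val ∧ k.val < d.2.val)

/-- The dihedral subgroup of `Perm (Fin n)`, generated by the rotation `i ↦ i + 1`
(mod `n`) and the reflection `i ↦ -i` (mod `n`). -/
def dihedral (n : ℕ) [NeZero n] : Subgroup (Equiv.Perm (Fin n)) :=
  Subgroup.closure {Equiv.addRight (1 : Fin n), Equiv.neg (Fin n)}

/-- `M_n(σ) = ∑_{T triangulation} ∏_{(i,j) ∈ T} (s (σ • arc (i,j)))⁻¹`. -/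
noncomputable def Msigma {n : ℕ} [NeZero n] (s : Finset (Fin n) → ℝ)
    (σ : Equiv.Perm (Fin n)) : ℝ :=
  ∑ T ∈ Finset.univ.filter (fun T : Finset (Fin n × Fin n) => IsTriangulation T),
    ∏ d ∈ T, (s (actSet σ (arcOf d)))⁻¹

/-- The crossing-symmetric φ³ amplitude: `∑_{C channel} ∏_{I ∈ C} (s I)⁻¹`. -/
noncomputable def Mamp {n : ℕ} [NeZero n] (s : Finset (Fin n) → ℝ) : ℝ :=
  ∑ C ∈ Finset.univ.filter (fun C : Finset (Finset (Fin n)) => IsChannel C),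
    ∏ I ∈ C, (s I)⁻¹

section Laminar

/-- Any two members of the family are nested or disjoint. -/
def IsLaminar {α : Type*} (L : Finset (Finset α)) : Prop :=
  ∀ A ∈ L, ∀ B ∈ L, A ⊆ B ∨ B ⊆ A ∨ Disjoint A B

/-- Convexity of a finite set with respect to a relation. -/
def IsConvexFor {α : Type*} (r : α → α → Prop) (A : Finset α) : Prop :=
  ∀ x ∈ A, ∀ y ∈ A, ∀ z, r x z → r z y → z ∈ A

/-- The map merging `b` into `a`. -/
noncomputable def merge {α : Type*} {a b : α} (hab : a ≠ b) (x : α) : {x : α // x ≠ b} :=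
  if h : x = b then ⟨a, hab⟩ else ⟨x, h⟩

variable {α : Type*} {a b : α} (hab : a ≠ b)

lemma merge_self : merge hab b = ⟨a, hab⟩ := by simp [merge]

lemma merge_of_ne {x : α} (h : x ≠ b) : merge hab x = ⟨x, h⟩ := by simp [merge, h]

lemma merge_coe (x : {x : α // x ≠ b}) : merge hab x = x := by
  simp [merge, x.2]

lemma merge_eq_iff {x y : α} :
    merge hab x = merge hab y ↔ x = y ∨ (x = a ∧ y = b) ∨ (x = b ∧ y = a) := by
  unfold merge
  split_ifs <;> grind

lemma merge_mem_image {A : Finset α} (hA : a ∈ A ↔ b ∈ A) {x : α} :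
    merge hab x ∈ A.image (merge hab) ↔ x ∈ A := by
  simp only [Finset.mem_image, merge_eq_iff]
  grind

lemma image_merge_subset {A B : Finset α} (hB : a ∈ B ↔ b ∈ B) :
    A.image (merge hab) ⊆ B.image (merge hab) ↔ A ⊆ B := by
  refine ⟨fun h x hx => ?_, Finset.image_subset_image⟩
  exact (merge_mem_image hab hB).1 (h (Finset.mem_image_of_mem _ hx))

lemma disjoint_image_merge {A B : Finset α} (hB : a ∈ B ↔ b ∈ B) (h : Disjoint A B) :
    Disjoint (A.image (merge hab)) (B.image (merge hab)) := by
  rw [Finset.disjoint_left] at h ⊢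
  intro z hz
  obtain ⟨x, hx, rfl⟩ := Finset.mem_image.1 hz
  rw [merge_mem_image hab hB]
  exact h hx

lemma image_merge_injOn {L : Finset (Finset α)} (hL : ∀ A ∈ L, a ∈ A ↔ b ∈ A) :
    Set.InjOn (Finset.image (merge hab)) (L : Set (Finset α)) := by
  intro A hA B hB h
  exact Finset.Subset.antisymm
    ((image_merge_subset hab (hL B hB)).1 h.subset)
    ((image_merge_subset hab (hL A hA)).1 h.superset)

lemma IsLaminar.mono {L L' : Finset (Finset α)} (h : IsLaminar L) (hL : L' ⊆ L) :
    IsLaminar L' :=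
  fun A hA B hB => h A (hL hA) B (hL hB)

lemma IsLaminar.image_merge {L : Finset (Finset α)} (h : IsLaminar L)
    (hL : ∀ A ∈ L, a ∈ A ↔ b ∈ A) : IsLaminar (L.image (Finset.image (merge hab))) := by
  intro A' hA' B' hB'
  obtain ⟨A, hA, rfl⟩ := Finset.mem_image.1 hA'
  obtain ⟨B, hB, rfl⟩ := Finset.mem_image.1 hB'
  rcases h A hA B hB with h | h | h
  · exact .inl (Finset.image_subset_image h)
  · exact .inr (.inl (Finset.image_subset_image h))
  · exact .inr (.inr (disjoint_image_merge hab (hL B hB) h))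

/-- The image of a set which is neither `{a, b}` nor trivial is nontrivial. -/
lemma two_le_card_image_merge {A : Finset α} (hA : a ∈ A ↔ b ∈ A) (h2 : 2 ≤ A.card)
    (hne : A ≠ {a, b}) : 2 ≤ (A.image (merge hab)).card := by
  by_cases ha : a ∈ A
  · have hsub : {a, b} ⊆ A := by
      intro x; simp only [Finset.mem_insert, Finset.mem_singleton]; grind
    obtain ⟨c, hc, hc'⟩ := Finset.exists_of_ssubset (hsub.ssubset_of_ne hne.symm)
    simp only [Finset.mem_insert, Finset.mem_singleton, not_or] at hc'
    refine Finset.one_lt_card.2 ⟨_, Finset.mem_image_of_mem _ ha, _,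
      Finset.mem_image_of_mem _ hc, ?_⟩
    rw [Ne, merge_eq_iff]
    grind
  · rw [Finset.card_image_of_injOn]
    · exact h2
    · intro x hx y hy h
      rw [merge_eq_iff] at h
      have hx' : x ∈ A := hx
      have hy' : y ∈ A := hy
      grind

/-- Two elements of a minimal member of a laminar family belong to the same members. -/
lemma IsLaminar.exists_pair {L : Finset (Finset α)} (h : IsLaminar L)
    (h2 : ∀ A ∈ L, 2 ≤ A.card) (hne : L.Nonempty) :
    ∃ a b : α, a ≠ b ∧ (∀ A ∈ L, a ∈ A ↔ b ∈ A) := by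
  obtain ⟨J, hJ⟩ := Finset.exists_minimal hne
  obtain ⟨a, ha, b, hb, hab⟩ := Finset.one_lt_card.1 (h2 J hJ.prop)
  refine ⟨a, b, hab, fun A hA => ?_⟩
  rcases h A hA J hJ.prop with hs | hs | hs
  · have := hJ.le_of_le hA hs
    exact ⟨fun _ => this hb, fun _ => this ha⟩
  · exact ⟨fun _ => hs hb, fun _ => hs ha⟩
  · have := Finset.disjoint_right.1 hs
    exact ⟨fun h => absurd h (this ha), fun h => absurd h (this hb)⟩

lemma IsLaminar.card_lt {m : ℕ} : ∀ {α : Type*} [Fintype α], Fintype.card α = m + 1 →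
    ∀ {L : Finset (Finset α)}, IsLaminar L → (∀ A ∈ L, 2 ≤ A.card) → L.card ≤ m := by
  induction m with
  | zero =>
    intro α _ hα L _ h2
    rw [Nat.le_zero, Finset.card_eq_zero, Finset.eq_empty_iff_forall_notMem]
    intro A hA
    have := (h2 A hA).trans (Finset.card_le_univ A)
    omega
  | succ m ih =>
    intro α _ hα L h h2
    rcases L.eq_empty_or_nonempty with rfl | hne
    · simp
    obtain ⟨a, b, hab, hL⟩ := h.exists_pair h2 hne
    have hL' : ∀ A ∈ L.erase {a, b}, a ∈ A ↔ b ∈ A :=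
      fun A hA => hL A (Finset.mem_of_mem_erase hA)
    have key := ih (α := {x : α // x ≠ b}) (by simp [hα])
      ((h.mono (Finset.erase_subset {a, b} L)).image_merge hab hL') (by
        intro A' hA'
        obtain ⟨A, hA, rfl⟩ := Finset.mem_image.1 hA'
        exact two_le_card_image_merge hab (hL' A hA) (h2 A (Finset.mem_of_mem_erase hA))
          (Finset.ne_of_mem_erase hA))
    rw [Finset.card_image_of_injOn (image_merge_injOn hab hL')] at key
    have := Finset.pred_card_le_card_erase (s := L) (a := {a, b})
    omega

/-- A laminar family of maximal size contains a pair which no other member separates. -/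
lemma IsLaminar.exists_pair_mem {m : ℕ} [Fintype α] (hα : Fintype.card α = m + 2)
    {L : Finset (Finset α)} (h : IsLaminar L) (h2 : ∀ A ∈ L, 2 ≤ A.card)
    (hc : L.card = m + 1) :
    ∃ a b : α, a ≠ b ∧ (∀ A ∈ L, a ∈ A ↔ b ∈ A) ∧ {a, b} ∈ L := by
  obtain ⟨a, b, hab, hL⟩ := h.exists_pair h2 (Finset.card_pos.1 (by omega))
  refine ⟨a, b, hab, hL, ?_⟩
  by_contra hJ
  have key := IsLaminar.card_lt (α := {x : α // x ≠ b}) (m := m) (by simp [hα])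
    (h.image_merge hab hL) (by
      intro A' hA'
      obtain ⟨A, hA, rfl⟩ := Finset.mem_image.1 hA'
      exact two_le_card_image_merge hab (hL A hA) (h2 A hA) (by rintro rfl; exact hJ hA))
  rw [Finset.card_image_of_injOn (image_merge_injOn hab hL)] at key
  omega

/-- Splitting a point `a` of a strict order into two adjacent points `a` and `b`, with `a`
before `b` if and only if `c` is true. -/
def splitRel (r : {x : α // x ≠ b} → {x : α // x ≠ b} → Prop) (c : Bool) (x y : α) : Prop :=
  r (merge hab x) (merge hab y) ∨ (x = a ∧ y = b ∧ c = true) ∨ (x = b ∧ y = a ∧ c = false)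

lemma splitRel_strictTotal {r : {x : α // x ≠ b} → {x : α // x ≠ b} → Prop}
    (hr : IsStrictTotalOrder _ r) (c : Bool) : IsStrictTotalOrder α (splitRel hab r c) where
  trichotomous x y := by
    have h1 := hr.trichotomous (merge hab x) (merge hab y)
    rw [merge_eq_iff] at h1
    cases c <;> grind [splitRel]
  irrefl x := by
    have := hr.irrefl (merge hab x)
    grind [splitRel]
  trans x y z := by
    have h1 := hr.trans (merge hab x) (merge hab y) (merge hab z)
    have h2 := hr.irrefl (merge hab a)
    have h3 : merge hab b = merge hab a := by simp [merge_eq_iff]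
    have h4 := hr.irrefl (merge hab x)
    cases c <;> grind [splitRel]

lemma isConvexFor_splitRel {r : {x : α // x ≠ b} → {x : α // x ≠ b} → Prop} {c : Bool}
    {A : Finset α} (hA : a ∈ A ↔ b ∈ A) :
    IsConvexFor (splitRel hab r c) A ↔ IsConvexFor r (A.image (merge hab)) := by
  constructor
  · intro h x' hx' y' hy' z' hxz hzy
    obtain ⟨x, hx, rfl⟩ := Finset.mem_image.1 hx'
    obtain ⟨y, hy, rfl⟩ := Finset.mem_image.1 hy'
    rw [← merge_coe hab z'] at *
    rw [merge_mem_image hab hA]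
    exact h x hx y hy _ (.inl hxz) (.inl hzy)
  · intro h x hx y hy z hxz hzy
    rcases hxz with hxz | hxz
    · rcases hzy with hzy | hzy
      · rw [← merge_mem_image hab hA]
        exact h _ (Finset.mem_image_of_mem _ hx) _ (Finset.mem_image_of_mem _ hy) _ hxz hzy
      · grind
    · grind

lemma isConvexFor_splitRel_pair {r : {x : α // x ≠ b} → {x : α // x ≠ b} → Prop}
    (hr : IsStrictTotalOrder _ r) (c : Bool) : IsConvexFor (splitRel hab r c) {a, b} := by
  rw [isConvexFor_splitRel hab (by simp)]
  have h : merge hab b = merge hab a := by simp [merge_eq_iff]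
  have h2 := hr.irrefl (merge hab a)
  intro x hx y hy z hxz hzy
  have h3 := hr.trans x z y
  simp only [Finset.image_insert, Finset.image_singleton, h, Finset.mem_insert,
    Finset.mem_singleton, or_self] at *
  subst hx hy
  exact absurd (h3 hxz hzy) h2

lemma restrict_strictTotal {r : α → α → Prop} (hr : IsStrictTotalOrder α r) (p : α → Prop) :
    IsStrictTotalOrder {x : α // p x} (fun x y => r x y) where
  trichotomous x y h1 h2 := Subtype.ext (hr.trichotomous x y h1 h2)
  irrefl x := hr.irrefl x
  trans x y z := hr.trans x y z

lemma splitRel_restrict {r : α → α → Prop} (hr : IsStrictTotalOrder α r)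
    (hJ : IsConvexFor r {a, b}) :
    splitRel hab (fun x y => r x y) (decide (r a b)) = r := by
  funext x y
  have irr := hr.irrefl
  have tri := hr.trichotomous
  have tra := hr.trans
  have hj1 := hJ a (by simp) b (by simp)
  have hj2 := hJ b (by simp) a (by simp)
  simp only [Finset.mem_insert, Finset.mem_singleton] at hj1 hj2
  rw [eq_iff_iff, splitRel]
  by_cases hx : x = b <;> by_cases hy : y = b
  · subst hx hy; simp [merge_self]; grind
  · subst hx
    simp only [merge_self, merge_of_ne hab hy]
    grind
  · subst hy
    simp only [merge_self, merge_of_ne hab hx]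
    grind
  · simp only [merge_of_ne hab hx, merge_of_ne hab hy]
    grind

/-- The strict total orders for which every member of `L` is convex. -/
abbrev ConvexOrder {α : Type*} (L : Finset (Finset α)) : Type _ :=
  {r : α → α → Prop // IsStrictTotalOrder α r ∧ ∀ A ∈ L, IsConvexFor r A}

/-- Merging the elements of a pair in `L` halves the number of convex orders. -/
noncomputable def convexOrderEquiv {L : Finset (Finset α)} (hL : ∀ A ∈ L, a ∈ A ↔ b ∈ A)
    (hJ : {a, b} ∈ L) :
    ConvexOrder L ≃
      ConvexOrder ((L.erase {a, b}).image (Finset.image (merge hab))) × Bool where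
  toFun r := (⟨fun x y => r.1 x y, restrict_strictTotal r.2.1 _, by
    intro A' hA'
    obtain ⟨A, hA, rfl⟩ := Finset.mem_image.1 hA'
    have hA := Finset.mem_of_mem_erase hA
    rw [← isConvexFor_splitRel hab (c := decide (r.1 a b)) (hL A hA),
      splitRel_restrict hab r.2.1 (r.2.2 _ hJ)]
    exact r.2.2 A hA⟩, decide (r.1 a b))
  invFun q := ⟨splitRel hab q.1.1 q.2, splitRel_strictTotal hab q.1.2.1 _, by
    intro A hA
    by_cases h : A = {a, b}
    · rw [h]
      exact isConvexFor_splitRel_pair hab q.1.2.1 _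
    · rw [isConvexFor_splitRel hab (hL A hA)]
      exact q.1.2.2 _ (Finset.mem_image_of_mem _ (Finset.mem_erase.2 ⟨h, hA⟩))⟩
  left_inv r := Subtype.ext (splitRel_restrict hab r.2.1 (r.2.2 _ hJ))
  right_inv q := by
    obtain ⟨⟨r, hr, hq⟩, c⟩ := q
    have h1 : ∀ x y : {x : α // x ≠ b}, splitRel hab r c x y ↔ r x y := by
      intro x y
      have := x.2
      have := y.2
      simp only [splitRel, merge_coe]
      grind
    have h2 : splitRel hab r c a b ↔ c = true := by
      have := hr.irrefl ⟨a, hab⟩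
      simp only [splitRel, merge_self, merge_of_ne hab hab]
      grind
    simp only [h1, h2, Bool.decide_eq_true]

lemma card_convexOrder {m : ℕ} : ∀ {α : Type*} [Fintype α], Fintype.card α = m + 1 →
    ∀ {L : Finset (Finset α)}, IsLaminar L → (∀ A ∈ L, 2 ≤ A.card) → L.card = m →
    Nat.card (ConvexOrder L) = 2 ^ m := by
  induction m with
  | zero =>
    intro α _ hα L _ _ hc
    obtain rfl := Finset.card_eq_zero.1 hc
    have hsub : Subsingleton α := Fintype.card_le_one_iff_subsingleton.1 hα.le
    rw [pow_zero, Nat.card_eq_one_iff_unique]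
    refine ⟨⟨fun r r' => Subtype.ext ?_⟩, ⟨⟨fun _ _ => False, { trichotomous := fun x y _ _ => Subsingleton.elim x y, irrefl := fun _ => id, trans := fun _ _ _ => False.elim }, by simp⟩⟩⟩
    · funext x y
      have h1 := r.2.1.irrefl x
      have h2 := r'.2.1.irrefl x
      rw [Subsingleton.elim y x, eq_iff_iff]
      tauto
  | succ m ih =>
    intro α _ hα L h h2 hc
    obtain ⟨a, b, hab, hL, hJ⟩ := h.exists_pair_mem hα h2 hc
    have hL' : ∀ A ∈ L.erase {a, b}, a ∈ A ↔ b ∈ A :=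
      fun A hA => hL A (Finset.mem_of_mem_erase hA)
    rw [Nat.card_congr (convexOrderEquiv hab hL hJ), Nat.card_prod, pow_succ,
      ih (α := {x : α // x ≠ b}) (by simp [hα])
        ((h.mono (Finset.erase_subset {a, b} L)).image_merge hab hL')]
    · simp
    · intro A' hA'
      obtain ⟨A, hA, rfl⟩ := Finset.mem_image.1 hA'
      exact two_le_card_image_merge hab (hL' A hA) (h2 A (Finset.mem_of_mem_erase hA))
        (Finset.ne_of_mem_erase hA)
    · rw [Finset.card_image_of_injOn (image_merge_injOn hab hL'), Finset.card_erase_of_mem hJ,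
        hc, Nat.add_sub_cancel]

end Laminar

section Permutations

/-- The strict total order in which the values of a permutation are listed. -/
def permOrder {n : ℕ} (σ : Equiv.Perm (Fin n)) (x y : Fin n) : Prop := σ.symm x < σ.symm y

lemma permOrder_strictTotal {n : ℕ} (σ : Equiv.Perm (Fin n)) :
    IsStrictTotalOrder (Fin n) (permOrder σ) where
  trichotomous _ _ h1 h2 := σ.symm.injective (le_antisymm (not_lt.1 h2) (not_lt.1 h1))
  irrefl x := lt_irrefl (σ.symm x)
  trans _ _ _ := lt_trans

lemma permOrder_injective {n : ℕ} : Function.Injective (permOrder (n := n)) := by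
  intro σ τ h
  have hlt : ∀ x y, σ.symm x < σ.symm y ↔ τ.symm x < τ.symm y :=
    fun x y => iff_of_eq (congrFun (congrFun h x) y)
  let e : Fin n ≃o Fin n :=
    { toEquiv := σ.trans τ.symm
      map_rel_iff' := by
        intro x y
        have := hlt (σ y) (σ x)
        simp only [Equiv.symm_apply_apply] at this
        simp only [Equiv.trans_apply, ← not_lt, ← this] }
  have he : e = OrderIso.refl _ := Subsingleton.elim _ _
  ext x
  have h1 : e x = x := by rw [he]; rfl
  have h2 : τ.symm (σ x) = x := h1
  rw [Equiv.symm_apply_eq] at h2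
  rw [h2]

lemma exists_equiv_fin_lt {β : Type*} [Fintype β] {n : ℕ} (hβ : Fintype.card β = n)
    {r : β → β → Prop} (hr : IsStrictTotalOrder β r) :
    ∃ e : Fin n ≃ β, ∀ x y, e.symm x < e.symm y ↔ r x y := by
  let lo : LinearOrder β := linearOrderOfSTO r
  let e := Fintype.orderIsoFinOfCardEq β hβ
  exact ⟨e.toEquiv, fun x y => e.symm.lt_iff_lt⟩

lemma exists_permOrder {n : ℕ} {r : Fin n → Fin n → Prop} (hr : IsStrictTotalOrder (Fin n) r) :
    ∃ σ, permOrder σ = r := by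
  obtain ⟨e, he⟩ := exists_equiv_fin_lt (Fintype.card_fin n) hr
  exact ⟨e, funext fun x => funext fun y => propext (he x y)⟩

lemma card_perm_convex {n : ℕ} (hn : 1 ≤ n) {L : Finset (Finset (Fin n))} (h : IsLaminar L)
    (h2 : ∀ A ∈ L, 2 ≤ A.card) (hc : L.card = n - 1) :
    (Finset.univ.filter fun σ : Equiv.Perm (Fin n) =>
      ∀ A ∈ L, IsConvexFor (permOrder σ) A).card = 2 ^ (n - 1) := by
  rw [← card_convexOrder (by simp; omega) h h2 hc, ← Fintype.card_subtype,
    ← Nat.card_eq_fintype_card]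
  refine Nat.card_congr (Equiv.ofBijective
    (fun σ => ⟨permOrder σ.1, permOrder_strictTotal _, σ.2⟩) ⟨?_, ?_⟩)
  · intro σ τ h
    exact Subtype.ext (permOrder_injective (congrArg Subtype.val h))
  · rintro ⟨r, hr, hr'⟩
    obtain ⟨σ, rfl⟩ := exists_permOrder hr
    exact ⟨⟨σ, hr'⟩, rfl⟩

end Permutations

section Splits

variable {n : ℕ}

lemma image_perm_eq_iff {σ : Equiv.Perm (Fin n)} {A B : Finset (Fin n)} :
    A.image σ = B ↔ ∀ k, k ∈ A ↔ σ k ∈ B := by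
  rw [Finset.ext_iff, σ.surjective.forall]
  simp

lemma image_perm_compl (σ : Equiv.Perm (Fin n)) (A : Finset (Fin n)) :
    Aᶜ.image σ = (A.image σ)ᶜ := by
  rw [image_perm_eq_iff]
  simp

lemma mem_arcOf {d : Fin n × Fin n} {k : Fin n} :
    k ∈ arcOf d ↔ d.1.val ≤ k.val ∧ k.val < d.2.val := by
  simp [arcOf]

lemma card_arcOf (d : Fin n × Fin n) : (arcOf d).card = d.2.val - d.1.val := by
  rw [← Fin.card_Ico]
  congr 1
  ext k
  simp only [mem_arcOf, Finset.mem_Ico]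
  rfl

lemma IsDiagonal.card_arcOf_le {d : Fin n × Fin n} (hd : IsDiagonal d) :
    2 ≤ (arcOf d).card ∧ (arcOf d).card ≤ n - 2 := by
  rw [card_arcOf]
  unfold IsDiagonal at hd
  omega

lemma arcOf_injOn {d e : Fin n × Fin n} (hd : IsDiagonal d) (he : IsDiagonal e)
    (h : arcOf d = arcOf e) : d = e := by
  simp only [Finset.ext_iff, mem_arcOf] at h
  unfold IsDiagonal at hd he
  have h1 := h d.1
  have h2 := h d.2
  have h3 := h e.1
  have h4 := h e.2
  ext <;> omega

/-- The arcs of two diagonals do not cross the boundary between the last and the first vertex,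
so noncrossing diagonals have nested or disjoint arcs. -/
lemma not_cross_iff {d e : Fin n × Fin n} (hd : IsDiagonal d) (he : IsDiagonal e) :
    ¬ Cross d e ↔ arcOf d ⊆ arcOf e ∨ arcOf e ⊆ arcOf d ∨ Disjoint (arcOf d) (arcOf e) := by
  simp only [Finset.disjoint_left, Finset.subset_iff, mem_arcOf]
  unfold IsDiagonal at hd he
  simp only [Cross, Fin.lt_def]
  constructor
  · intro h
    by_cases h1 : e.1.val ≤ d.1.val ∧ d.2.val ≤ e.2.val
    · exact .inl fun k hk => by omega
    by_cases h2 : d.1.val ≤ e.1.val ∧ e.2.val ≤ d.2.val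
    · exact .inr (.inl fun k hk => by omega)
    · exact .inr (.inr fun k hk => by omega)
  · rintro (h | h | h)
    · have h1 := @h d.1
      have h2 := @h e.2
      have h3 := @h e.1
      have h4 := @h ⟨d.2.val - 1, by omega⟩
      simp only at h4
      omega
    · have h1 := @h d.1
      have h2 := @h e.2
      have h3 := @h e.1
      have h4 := @h ⟨e.2.val - 1, by omega⟩
      simp only at h4
      omega
    · have h1 := @h d.1
      have h2 := @h e.1
      omega

variable [NeZero n]

lemma zero_mem_normSet (J : Finset (Fin n)) : 0 ∈ normSet J := by
  unfold normSet
  split_ifs with h <;> simp [h]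

lemma normSet_compl (J : Finset (Fin n)) : normSet Jᶜ = normSet J := by
  unfold normSet
  by_cases h : 0 ∈ J <;> simp [h]

lemma normSet_of_zero_mem {J : Finset (Fin n)} (h : 0 ∈ J) : normSet J = J := if_pos h

lemma normSet_eq_or (J : Finset (Fin n)) : normSet J = J ∨ normSet J = Jᶜ := by
  unfold normSet
  split_ifs <;> simp

lemma normSet_eq_iff {I J : Finset (Fin n)} : normSet I = normSet J ↔ I = J ∨ I = Jᶜ := by
  constructor
  · intro h
    rcases normSet_eq_or I with hI | hI <;> rcases normSet_eq_or J with hJ | hJ <;>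
      rw [hI, hJ] at h
    · exact .inl h
    · exact .inr h
    · rw [← h, compl_compl]
      exact .inr rfl
    · exact .inl (compl_injective h)
  · rintro (rfl | rfl)
    · rfl
    · exact normSet_compl J

lemma isSplit_normSet {J : Finset (Fin n)} (h2 : 2 ≤ J.card) (hn : J.card ≤ n - 2) :
    IsSplit (normSet J) := by
  refine ⟨zero_mem_normSet J, ?_⟩
  have := Finset.card_compl J
  rw [Fintype.card_fin] at this
  rcases normSet_eq_or J with h | h <;> rw [h] <;> omega

lemma compatible_normSet {A B : Finset (Fin n)} :
    Compatible (normSet A) (normSet B) ↔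
      A ⊆ B ∨ B ⊆ A ∨ Disjoint A B ∨ A ∪ B = Finset.univ := by
  simp only [Compatible, normSet]
  split_ifs with hA hB hB <;>
    simp only [Finset.subset_iff, Finset.disjoint_left, Finset.eq_univ_iff_forall,
      Finset.mem_union, Finset.mem_compl] <;>
    grind

lemma actSet_compl (σ : Equiv.Perm (Fin n)) (J : Finset (Fin n)) :
    actSet σ Jᶜ = actSet σ J := by
  rw [actSet, actSet, image_perm_compl]
  exact normSet_compl _

lemma isSplit_actSet (σ : Equiv.Perm (Fin n)) {d : Fin n × Fin n} (hd : IsDiagonal d) :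
    IsSplit (actSet σ (arcOf d)) := by
  have hc := Finset.card_image_of_injective (arcOf d) σ.injective
  exact isSplit_normSet (hc ▸ hd.card_arcOf_le.1) (hc ▸ hd.card_arcOf_le.2)

lemma last_notMem_arcOf (d : Fin n × Fin n) : Fin.rev 0 ∉ arcOf d := by
  rw [mem_arcOf, Fin.val_rev, Fin.val_zero]
  omega

lemma actSet_arcOf_injOn (σ : Equiv.Perm (Fin n)) {d e : Fin n × Fin n} (hd : IsDiagonal d)
    (he : IsDiagonal e) (h : actSet σ (arcOf d) = actSet σ (arcOf e)) : d = e := by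
  rw [actSet, actSet, normSet_eq_iff, ← image_perm_compl] at h
  rcases h with h | h
  · exact arcOf_injOn hd he (Finset.image_injective σ.injective h)
  · have h := Finset.image_injective σ.injective h
    have h1 := last_notMem_arcOf d
    rw [h, Finset.mem_compl] at h1
    exact absurd (last_notMem_arcOf e) h1

lemma compatible_actSet_arcOf (σ : Equiv.Perm (Fin n)) {d e : Fin n × Fin n}
    (hd : IsDiagonal d) (he : IsDiagonal e) :
    Compatible (actSet σ (arcOf d)) (actSet σ (arcOf e)) ↔ ¬ Cross d e := by
  have h : arcOf d ∪ arcOf e ≠ Finset.univ := by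
    intro h
    have h1 := Finset.mem_univ (Fin.rev (0 : Fin n))
    rw [← h, Finset.mem_union] at h1
    exact h1.elim (last_notMem_arcOf d) (last_notMem_arcOf e)
  rw [actSet, actSet, compatible_normSet, Finset.image_subset_image_iff σ.injective,
    Finset.image_subset_image_iff σ.injective, Finset.disjoint_image σ.injective,
    ← Finset.image_union, not_cross_iff hd he,
    ← Finset.image_univ_of_surjective σ.surjective,
    (Finset.image_injective σ.injective).eq_iff]
  simp only [h, or_false]

/-- The split `I` is a pole of the planar amplitude with ordering `σ`. -/
def IsPlanarPole (σ : Equiv.Perm (Fin n)) (I : Finset (Fin n)) : Prop :=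
  ∃ d, IsDiagonal d ∧ actSet σ (arcOf d) = I

lemma Msigma_eq_sum_channels (s : Finset (Fin n) → ℝ) (σ : Equiv.Perm (Fin n)) :
    Msigma s σ = ∑ C ∈ Finset.univ.filter (fun C : Finset (Finset (Fin n)) => IsChannel C),
      if ∀ I ∈ C, IsPlanarPole σ I then ∏ I ∈ C, (s I)⁻¹ else 0 := by
  rw [← Finset.sum_filter, Msigma]
  have hinj : ∀ T : Finset (Fin n × Fin n), (∀ d ∈ T, IsDiagonal d) →
      Set.InjOn (fun d => actSet σ (arcOf d)) (T : Set (Fin n × Fin n)) :=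
    fun T hT d hd e he h => actSet_arcOf_injOn σ (hT d hd) (hT e he) h
  refine Finset.sum_bij (fun T _ => T.image fun d => actSet σ (arcOf d)) ?_ ?_ ?_ ?_
  · intro T hT
    simp only [Finset.mem_filter, Finset.mem_univ, true_and] at hT ⊢
    obtain ⟨hc, hd, hcr⟩ := hT
    refine ⟨⟨?_, ?_, ?_⟩, ?_⟩
    · rw [Finset.card_image_of_injOn (hinj T hd), hc]
    · intro I hI
      obtain ⟨d, hdT, rfl⟩ := Finset.mem_image.1 hI
      exact isSplit_actSet σ (hd d hdT)
    · intro I hI J hJ hIJ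
      obtain ⟨d, hdT, rfl⟩ := Finset.mem_image.1 hI
      obtain ⟨e, heT, rfl⟩ := Finset.mem_image.1 hJ
      rw [compatible_actSet_arcOf σ (hd d hdT) (hd e heT)]
      exact hcr d hdT e heT (by rintro rfl; exact hIJ rfl)
    · intro I hI
      obtain ⟨d, hdT, rfl⟩ := Finset.mem_image.1 hI
      exact ⟨d, hd d hdT, rfl⟩
  · intro T hT T' hT' h
    simp only [Finset.mem_filter, Finset.mem_univ, true_and] at hT hT'
    ext d
    constructor
    · intro hd
      have := Finset.mem_image_of_mem (fun d => actSet σ (arcOf d)) hd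
      rw [h] at this
      obtain ⟨e, he, hed⟩ := Finset.mem_image.1 this
      rwa [← actSet_arcOf_injOn σ (hT'.2.1 e he) (hT.2.1 d hd) hed]
    · intro hd
      have := Finset.mem_image_of_mem (fun d => actSet σ (arcOf d)) hd
      rw [← h] at this
      obtain ⟨e, he, hed⟩ := Finset.mem_image.1 this
      rwa [← actSet_arcOf_injOn σ (hT.2.1 e he) (hT'.2.1 d hd) hed]
  · intro C hC
    simp only [Finset.mem_filter, Finset.mem_univ, true_and] at hC
    obtain ⟨⟨hc, _, hcomp⟩, hpole⟩ := hC
    let T := Finset.univ.filter fun d : Fin n × Fin n => IsDiagonal d ∧ actSet σ (arcOf d) ∈ C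
    have hT : ∀ d, d ∈ T ↔ IsDiagonal d ∧ actSet σ (arcOf d) ∈ C := by simp [T]
    have himage : (T.image fun d => actSet σ (arcOf d)) = C := by
      ext I
      rw [Finset.mem_image]
      constructor
      · rintro ⟨d, hd, rfl⟩
        exact ((hT d).1 hd).2
      · intro hI
        obtain ⟨d, hd, rfl⟩ := hpole I hI
        exact ⟨d, (hT d).2 ⟨hd, hI⟩, rfl⟩
    have hdiag : ∀ d ∈ T, IsDiagonal d := fun d hd => ((hT d).1 hd).1
    refine ⟨T, ?_, himage⟩
    simp only [Finset.mem_filter, Finset.mem_univ, true_and]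
    refine ⟨?_, hdiag, fun d hd e he hde => ?_⟩
    · rw [← hc, ← himage, Finset.card_image_of_injOn (hinj T hdiag)]
    · rw [← compatible_actSet_arcOf σ (hdiag d hd) (hdiag e he)]
      exact hcomp _ ((hT d).1 hd).2 _ ((hT e).1 he).2
        fun h => hde (actSet_arcOf_injOn σ (hdiag d hd) (hdiag e he) h)
  · intro T hT
    simp only [Finset.mem_filter, Finset.mem_univ, true_and] at hT
    rw [Finset.prod_image (hinj T hT.2.1)]

end Splits

section Counting

variable {n : ℕ}

/-- A set avoiding one of the two ends of the line `0 < 1 < ⋯ < n - 1` is an arc or the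
complement of an arc if and only if it is convex. -/
lemma exists_arcOf_iff [NeZero n] {S : Finset (Fin n)} (h2 : 2 ≤ S.card) (hn : S.card ≤ n - 2)
    (hS : 0 ∉ S ∨ Fin.rev 0 ∉ S) :
    (∃ d, IsDiagonal d ∧ (arcOf d = S ∨ arcOf d = Sᶜ)) ↔ IsConvexFor (· < ·) S := by
  constructor
  · rintro ⟨d, -, rfl | hd⟩
    · intro i hi j hj k hik hkj
      rw [mem_arcOf] at *
      rw [Fin.lt_def] at *
      omega
    · have h0 : 0 ∉ S := by
        refine hS.resolve_right fun h => ?_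
        have := last_notMem_arcOf d
        rw [hd, Finset.mem_compl] at this
        exact this h
      have hmem : ∀ k, k ∈ S ↔ ¬ (d.1.val ≤ k.val ∧ k.val < d.2.val) := by
        intro k
        rw [← mem_arcOf, hd, Finset.mem_compl, not_not]
      have h1 := hmem 0
      rw [Fin.val_zero] at h1
      intro i hi j hj k hik hkj
      rw [hmem] at *
      rw [Fin.lt_def] at *
      omega
  · intro hconv
    have hne : S.Nonempty := Finset.card_pos.1 (by omega)
    set i := S.min' hne with hi
    set j := S.max' hne with hj
    have hiS : i ∈ S := S.min'_mem hne
    have hjS : j ∈ S := S.max'_mem hne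
    have hmem : ∀ k : Fin n, k ∈ S ↔ i.val ≤ k.val ∧ k.val ≤ j.val := by
      intro k
      constructor
      · exact fun hk => ⟨S.min'_le k hk, S.le_max' k hk⟩
      · rintro ⟨hik, hkj⟩
        rcases hik.eq_or_lt with h | h
        · rwa [← Fin.ext h]
        rcases hkj.eq_or_lt with h' | h'
        · rwa [Fin.ext h']
        · exact hconv i hiS j hjS k h h'
    have hcard : S.card = j.val + 1 - i.val := by
      rw [← Fin.card_Icc]
      congr 1
      ext k
      rw [hmem, Finset.mem_Icc]
      rfl
    have hjn := j.isLt
    by_cases hjl : j.val + 1 < n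
    · refine ⟨(i, ⟨j.val + 1, hjl⟩), ?_, .inl ?_⟩
      · unfold IsDiagonal
        simp only
        omega
      · ext k
        rw [mem_arcOf, hmem]
        simp only
        omega
    · have hi0 : i.val ≠ 0 := by
        intro h
        rcases hS with hS | hS
        · refine hS ?_
          have : i = 0 := Fin.ext h
          rwa [← this]
        · refine hS ?_
          have : j = Fin.rev 0 := by
            ext
            rw [Fin.val_rev, Fin.val_zero]
            omega
          rwa [← this]
      refine ⟨(0, i), ?_, .inr ?_⟩
      · unfold IsDiagonal
        simp only [Fin.val_zero]
        omega
      · ext k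
        rw [mem_arcOf, Finset.mem_compl, hmem]
        simp only [Fin.val_zero]
        omega

/-- The side of the split `{I, Iᶜ}` which does not contain `p`. -/
noncomputable def sideAvoiding (p : Fin n) (I : Finset (Fin n)) : Finset (Fin n) :=
  if p ∈ I then Iᶜ else I

lemma notMem_sideAvoiding (p : Fin n) (I : Finset (Fin n)) : p ∉ sideAvoiding p I := by
  unfold sideAvoiding
  split_ifs with h <;> simp [h]

lemma sideAvoiding_eq_or (p : Fin n) (I : Finset (Fin n)) :
    sideAvoiding p I = I ∨ sideAvoiding p I = Iᶜ := by
  unfold sideAvoiding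
  split_ifs <;> simp

lemma IsSplit.card_sideAvoiding [NeZero n] {I : Finset (Fin n)} (hI : IsSplit I) (p : Fin n) :
    2 ≤ (sideAvoiding p I).card ∧ (sideAvoiding p I).card ≤ n - 2 := by
  have := Finset.card_compl I
  rw [Fintype.card_fin] at this
  obtain ⟨-, h2, hn⟩ := hI
  rcases sideAvoiding_eq_or p I with h | h <;> rw [h] <;> omega

lemma sideAvoiding_injOn [NeZero n] (p : Fin n) {I J : Finset (Fin n)} (hI : IsSplit I)
    (hJ : IsSplit J) (h : sideAvoiding p I = sideAvoiding p J) : I = J := by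
  rw [← normSet_of_zero_mem hI.1, ← normSet_of_zero_mem hJ.1]
  have key : ∀ K : Finset (Fin n), normSet K = normSet (sideAvoiding p K) := by
    intro K
    rcases sideAvoiding_eq_or p K with h | h <;> rw [h]
    rw [normSet_compl]
  rw [key I, key J, h]

lemma isPlanarPole_iff [NeZero n] {σ : Equiv.Perm (Fin n)} {I : Finset (Fin n)}
    (hI : IsSplit I) {p : Fin n} (hp : p = σ 0 ∨ p = σ (Fin.rev 0)) :
    IsPlanarPole σ I ↔ IsConvexFor (permOrder σ) (sideAvoiding p I) := by
  set A := sideAvoiding p I with hA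
  have hpA : p ∉ A := notMem_sideAvoiding p I
  set S := A.image σ.symm with hS
  have hmem : ∀ k, k ∈ S ↔ σ k ∈ A := by
    intro k
    rw [hS, Finset.mem_image]
    constructor
    · rintro ⟨a, ha, rfl⟩
      rwa [Equiv.apply_symm_apply]
    · exact fun h => ⟨_, h, σ.symm_apply_apply k⟩
  have hcard : S.card = A.card := Finset.card_image_of_injective _ σ.symm.injective
  have hc := hI.card_sideAvoiding p
  rw [← hA, ← hcard] at hc
  have hconv : IsConvexFor (permOrder σ) A ↔ IsConvexFor (· < ·) S := by
    unfold IsConvexFor permOrder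
    rw [← σ.forall_congr_right]
    refine forall_congr' fun i => ?_
    rw [hmem, ← σ.forall_congr_right]
    refine imp_congr_right fun _ => forall_congr' fun j => ?_
    rw [hmem, ← σ.forall_congr_right]
    simp only [hmem, Equiv.symm_apply_apply]
  rw [hconv, ← exists_arcOf_iff hc.1 hc.2]
  · refine exists_congr fun d => and_congr_right fun _ => ?_
    have h1 : actSet σ (arcOf d) = I ↔ (arcOf d).image σ = A ∨ (arcOf d).image σ = Aᶜ := by
      have h2 : actSet σ (arcOf d) = I ↔ (arcOf d).image σ = I ∨ (arcOf d).image σ = Iᶜ := by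
        rw [← normSet_eq_iff, normSet_of_zero_mem hI.1, actSet]
      rw [h2, hA]
      rcases sideAvoiding_eq_or p I with h | h <;> rw [h]
      rw [compl_compl, or_comm]
    rw [h1, image_perm_eq_iff, image_perm_eq_iff, Finset.ext_iff, Finset.ext_iff]
    simp only [Finset.mem_compl, hmem]
  · rw [hmem, hmem]
    rcases hp with rfl | rfl
    · exact .inl hpA
    · exact .inr hpA

/-- The sides avoiding `p` of the splits in `C`, together with `{p}ᶜ` and the whole set. -/
noncomputable def rootedFamily (C : Finset (Finset (Fin n))) (p : Fin n) :
    Finset (Finset (Fin n)) :=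
  insert Finset.univ (insert {p}ᶜ (C.image (sideAvoiding p)))

lemma forall_mem_rootedFamily {C : Finset (Finset (Fin n))} {p : Fin n}
    {P : Finset (Fin n) → Prop} :
    (∀ A ∈ rootedFamily C p, P A) ↔
      P Finset.univ ∧ P {p}ᶜ ∧ ∀ I ∈ C, P (sideAvoiding p I) := by
  simp [rootedFamily]

lemma isConvexFor_compl_singleton [NeZero n] {σ : Equiv.Perm (Fin n)} {p : Fin n} :
    IsConvexFor (permOrder σ) {p}ᶜ ↔ p = σ 0 ∨ p = σ (Fin.rev 0) := by
  constructor
  · intro h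
    by_contra! hp
    obtain ⟨k, rfl⟩ := σ.surjective p
    rw [σ.injective.ne_iff, σ.injective.ne_iff] at hp
    have h1 := h (σ 0) (by simpa using hp.1.symm) (σ (Fin.rev 0)) (by simpa using hp.2.symm) (σ k)
    simp only [permOrder, Equiv.symm_apply_apply, Finset.mem_compl, Finset.mem_singleton,
      not_true_eq_false, Fin.lt_def, Fin.val_rev, Fin.val_zero, imp_false] at h1
    have h2 := Fin.val_ne_of_ne hp.1
    have h3 := Fin.val_ne_of_ne hp.2
    rw [Fin.val_zero] at h2
    rw [Fin.val_rev, Fin.val_zero] at h3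
    have := k.isLt
    omega
  · intro hp x hx y hy z hxz hzy
    rw [Finset.mem_compl, Finset.mem_singleton]
    rintro rfl
    unfold permOrder at hxz hzy
    rcases hp with rfl | rfl
    · rw [Equiv.symm_apply_apply, Fin.lt_def, Fin.val_zero] at hxz
      omega
    · rw [Equiv.symm_apply_apply, Fin.lt_def, Fin.val_rev, Fin.val_zero] at hzy
      omega

lemma forall_rootedFamily_isConvexFor_iff [NeZero n] {C : Finset (Finset (Fin n))}
    (hC : ∀ I ∈ C, IsSplit I) {σ : Equiv.Perm (Fin n)} {p : Fin n} :
    (∀ A ∈ rootedFamily C p, IsConvexFor (permOrder σ) A) ↔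
      (∀ I ∈ C, IsPlanarPole σ I) ∧ (p = σ 0 ∨ p = σ (Fin.rev 0)) := by
  rw [forall_mem_rootedFamily, isConvexFor_compl_singleton]
  have huniv : IsConvexFor (permOrder σ) Finset.univ := fun _ _ _ _ _ _ _ => Finset.mem_univ _
  simp only [huniv, true_and]
  rw [and_comm]
  exact and_congr_left fun hp => forall₂_congr fun I hI => (isPlanarPole_iff (hC I hI) hp).symm

lemma isLaminar_rootedFamily [NeZero n] {C : Finset (Finset (Fin n))} (hC : IsChannel C)
    (p : Fin n) : IsLaminar (rootedFamily C p) := by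
  have hsub : ∀ I, sideAvoiding p I ⊆ {p}ᶜ := by
    intro I
    rw [Finset.subset_compl_singleton]
    exact notMem_sideAvoiding p I
  unfold IsLaminar
  simp only [forall_mem_rootedFamily]
  refine ⟨by simp, by simp [hsub], fun I hI => ⟨by simp, by simp [hsub], fun J hJ => ?_⟩⟩
  by_cases hIJ : I = J
  · subst hIJ
    exact .inl subset_rfl
  have hc := hC.2.2 I hI J hJ hIJ
  simp only [Compatible, Finset.subset_iff, Finset.eq_univ_iff_forall, Finset.mem_union] at hc
  unfold sideAvoiding
  split_ifs with h1 h2 h2 <;>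
    simp only [Finset.disjoint_left, Finset.subset_iff, Finset.mem_compl] <;> grind

lemma two_le_card_of_mem_rootedFamily [NeZero n] (hn : 3 ≤ n) {C : Finset (Finset (Fin n))}
    (hC : ∀ I ∈ C, IsSplit I) (p : Fin n) : ∀ A ∈ rootedFamily C p, 2 ≤ A.card := by
  rw [forall_mem_rootedFamily, Finset.card_compl, Finset.card_univ, Finset.card_singleton,
    Fintype.card_fin]
  exact ⟨by omega, by omega, fun I hI => ((hC I hI).card_sideAvoiding p).1⟩

lemma card_rootedFamily [NeZero n] (hn : 3 ≤ n) {C : Finset (Finset (Fin n))}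
    (hC : IsChannel C) (p : Fin n) : (rootedFamily C p).card = n - 1 := by
  have hp : ({p}ᶜ : Finset (Fin n)).card = n - 1 := by
    rw [Finset.card_compl, Finset.card_singleton, Fintype.card_fin]
  have huniv : (Finset.univ : Finset (Fin n)).card = n := by simp
  rw [rootedFamily, Finset.card_insert_of_notMem, Finset.card_insert_of_notMem,
    Finset.card_image_of_injOn, hC.1]
  · omega
  · exact fun I hI J hJ h => sideAvoiding_injOn p (hC.2.1 I hI) (hC.2.1 J hJ) h
  · intro h
    obtain ⟨I, hI, h⟩ := Finset.mem_image.1 h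
    have := (hC.2.1 I hI).card_sideAvoiding p
    rw [h] at this
    omega
  · intro h
    rw [Finset.mem_insert] at h
    rcases h with h | h
    · rw [h] at huniv
      omega
    · obtain ⟨I, hI, h⟩ := Finset.mem_image.1 h
      have := (hC.2.1 I hI).card_sideAvoiding p
      rw [h] at this
      omega

/-- The number of orderings for which a given channel is planar. -/
lemma card_planar_perms [NeZero n] (hn : 3 ≤ n) {C : Finset (Finset (Fin n))}
    (hC : IsChannel C) :
    (Finset.univ.filter fun σ : Equiv.Perm (Fin n) => ∀ I ∈ C, IsPlanarPole σ I).card =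
      n * 2 ^ (n - 2) := by
  have h1 : ∀ p : Fin n, (Finset.univ.filter fun σ : Equiv.Perm (Fin n) =>
      (∀ I ∈ C, IsPlanarPole σ I) ∧ (p = σ 0 ∨ p = σ (Fin.rev 0))).card = 2 ^ (n - 1) := by
    intro p
    simp only [← forall_rootedFamily_isConvexFor_iff hC.2.1]
    exact card_perm_convex (by omega) (isLaminar_rootedFamily hC p)
      (two_le_card_of_mem_rootedFamily hn hC.2.1 p) (card_rootedFamily hn hC p)
  have h2 : ∀ σ : Equiv.Perm (Fin n),
      (Finset.univ.filter fun p => p = σ 0 ∨ p = σ (Fin.rev 0)).card = 2 := by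
    intro σ
    rw [Finset.card_eq_two]
    refine ⟨σ 0, σ (Fin.rev 0), ?_, by ext; simp⟩
    rw [σ.injective.ne_iff, Ne, Fin.ext_iff, Fin.val_rev, Fin.val_zero]
    omega
  have h3 := Finset.sum_card_bipartiteAbove_eq_sum_card_bipartiteBelow
    (s := Finset.univ.filter fun σ : Equiv.Perm (Fin n) => ∀ I ∈ C, IsPlanarPole σ I)
    (t := Finset.univ) (fun σ p => p = σ 0 ∨ p = σ (Fin.rev 0))
  simp only [Finset.bipartiteAbove, Finset.bipartiteBelow, Finset.filter_filter, h1, h2,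
    Finset.sum_const, Finset.card_univ, Fintype.card_fin, smul_eq_mul] at h3
  obtain ⟨m, rfl⟩ : ∃ m, n = m + 2 := ⟨n - 2, by omega⟩
  simp only [Nat.add_sub_cancel, Nat.add_succ_sub_one, pow_succ] at h3 ⊢
  linarith

lemma sum_Msigma [NeZero n] (hn : 3 ≤ n) (s : Finset (Fin n) → ℝ) :
    ∑ σ : Equiv.Perm (Fin n), Msigma s σ = (n : ℝ) * 2 ^ (n - 2) * Mamp s := by
  simp only [Msigma_eq_sum_channels]
  rw [Finset.sum_comm, Mamp, Finset.mul_sum]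
  refine Finset.sum_congr rfl fun C hC => ?_
  rw [← Finset.sum_filter, Finset.sum_const, card_planar_perms hn (Finset.mem_filter.1 hC).2,
    nsmul_eq_mul]
  push_cast
  ring

end Counting

section Dihedral

variable {n : ℕ}

lemma val_neg_eq_ite (k : Fin n) : (-k).val = if k.val = 0 then 0 else n - k.val := by
  have hk := k.isLt
  rw [Fin.val_neg']
  split_ifs with h
  · rw [h, Nat.sub_zero, Nat.mod_self]
  · rw [Nat.mod_eq_of_lt (by omega)]

lemma exists_arcOf_image_reflection {d : Fin n × Fin n} (hd : IsDiagonal d) :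
    ∃ e, IsDiagonal e ∧ ((arcOf e).image (Equiv.neg (Fin n)) = arcOf d ∨
      (arcOf e).image (Equiv.neg (Fin n)) = (arcOf d)ᶜ) := by
  simp_rw [image_perm_eq_iff]
  simp only [Finset.mem_compl, mem_arcOf, Equiv.neg_apply, val_neg_eq_ite]
  obtain ⟨⟨i, hi⟩, ⟨j, hj⟩⟩ := d
  simp only [IsDiagonal] at *
  by_cases h0 : i = 0
  · refine ⟨(⟨1, by omega⟩, ⟨n - j + 1, by omega⟩), ?_, .inr fun k => ?_⟩
    · simp only
      omega
    · simp only
      split_ifs <;> omega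
  by_cases h1 : i = 1
  · refine ⟨(⟨0, by omega⟩, ⟨n - j + 1, by omega⟩), ?_, .inr fun k => ?_⟩
    · simp only
      omega
    · simp only
      split_ifs <;> omega
  · refine ⟨(⟨n - j + 1, by omega⟩, ⟨n - i + 1, by omega⟩), ?_, .inl fun k => ?_⟩
    · simp only
      omega
    · simp only
      split_ifs <;> omega

variable [NeZero n]

lemma val_add_one_eq_ite (hn : 3 ≤ n) (k : Fin n) :
    (k + 1).val = if k.val + 1 = n then 0 else k.val + 1 := by
  have hk := k.isLt
  rw [Fin.val_add, Fin.val_one', Nat.mod_eq_of_lt (a := 1) (by omega)]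
  split_ifs with h
  · rw [h, Nat.mod_self]
  · rw [Nat.mod_eq_of_lt (by omega)]

lemma exists_arcOf_image_rotation (hn : 3 ≤ n) {d : Fin n × Fin n} (hd : IsDiagonal d) :
    ∃ e, IsDiagonal e ∧ ((arcOf e).image (Equiv.addRight (1 : Fin n)) = arcOf d ∨
      (arcOf e).image (Equiv.addRight (1 : Fin n)) = (arcOf d)ᶜ) := by
  simp_rw [image_perm_eq_iff]
  simp only [Finset.mem_compl, mem_arcOf, Equiv.coe_addRight,
    val_add_one_eq_ite hn]
  obtain ⟨⟨i, hi⟩, ⟨j, hj⟩⟩ := d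
  simp only [IsDiagonal] at *
  by_cases h : i = 0
  · refine ⟨(⟨j - 1, by omega⟩, ⟨n - 1, by omega⟩), ?_, .inr fun k => ?_⟩
    · simp only
      omega
    · simp only
      split_ifs <;> omega
  · refine ⟨(⟨i - 1, by omega⟩, ⟨j - 1, by omega⟩), ?_, .inl fun k => ?_⟩
    · simp only
      omega
    · simp only
      split_ifs <;> omega

lemma actSet_mul (σ τ : Equiv.Perm (Fin n)) (J : Finset (Fin n)) :
    actSet (σ * τ) J = actSet σ (J.image τ) := by
  rw [actSet, actSet, Finset.image_image, Equiv.Perm.coe_mul]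

/-- Dihedral symmetries preserve the planar poles. -/
lemma IsPlanarPole.mul_right (hn : 3 ≤ n) {δ : Equiv.Perm (Fin n)} (hδ : δ ∈ dihedral n)
    {σ : Equiv.Perm (Fin n)} {I : Finset (Fin n)} (h : IsPlanarPole σ I) :
    IsPlanarPole (σ * δ) I := by
  have key : ∀ δ : Equiv.Perm (Fin n), (∀ d : Fin n × Fin n, IsDiagonal d → ∃ e, IsDiagonal e ∧
      ((arcOf e).image δ = arcOf d ∨ (arcOf e).image δ = (arcOf d)ᶜ)) →
      ∀ σ I, IsPlanarPole σ I → IsPlanarPole (σ * δ) I := by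
    rintro δ hδ σ I ⟨d, hd, rfl⟩
    obtain ⟨e, he, h⟩ := hδ d hd
    refine ⟨e, he, ?_⟩
    rw [actSet_mul]
    rcases h with h | h <;> rw [h]
    exact actSet_compl σ _
  have hδ' : δ ∈ Submonoid.closure {Equiv.addRight (1 : Fin n), Equiv.neg (Fin n)} := by
    rw [← Subgroup.closure_toSubmonoid_of_finite]
    exact hδ
  clear hδ
  induction hδ' using Submonoid.closure_induction generalizing σ with
  | mem x hx =>
    rcases hx with rfl | rfl
    · exact key _ (fun _ => exists_arcOf_image_rotation hn) _ _ h
    · exact key _ (fun _ => exists_arcOf_image_reflection) _ _ h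
  | one => rwa [mul_one]
  | mul x y _ _ hx hy =>
    rw [← mul_assoc]
    exact hy (hx h)

lemma Msigma_mul_dihedral (hn : 3 ≤ n) (s : Finset (Fin n) → ℝ) {δ : Equiv.Perm (Fin n)}
    (hδ : δ ∈ dihedral n) (σ : Equiv.Perm (Fin n)) : Msigma s (σ * δ) = Msigma s σ := by
  have h : ∀ I, IsPlanarPole (σ * δ) I ↔ IsPlanarPole σ I := by
    refine fun I => ⟨fun h => ?_, fun h => h.mul_right hn hδ⟩
    have := h.mul_right hn (inv_mem hδ)
    rwa [mul_inv_cancel_right] at this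
  simp only [Msigma_eq_sum_channels, h]

/-- The rotations (for `b = false`) and reflections (for `b = true`) of the `n`-gon. -/
def dihedralPerm (q : Fin n × Bool) : Equiv.Perm (Fin n) :=
  if q.2 then Equiv.addRight q.1 * Equiv.neg (Fin n) else Equiv.addRight q.1

lemma dihedralPerm_apply (c : Fin n) (b : Bool) (x : Fin n) :
    dihedralPerm (c, b) x = if b then -x + c else x + c := by
  cases b <;> rfl

lemma dihedralPerm_injective (hn : 3 ≤ n) : Function.Injective (dihedralPerm (n := n)) := by
  rintro ⟨c, b⟩ ⟨c', b'⟩ h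
  have h0 := Equiv.congr_fun h 0
  have h1 := Equiv.congr_fun h 1
  simp only [dihedralPerm_apply, neg_zero, zero_add, ite_self] at h0 h1
  subst h0
  have hne : (1 : Fin n) ≠ -1 := by
    intro h
    have := congrArg Fin.val h
    rw [val_neg_eq_ite, Fin.val_one', Nat.mod_eq_of_lt (by omega)] at this
    split_ifs at this <;> omega
  cases b <;> cases b' <;> simp_all [eq_comm]

lemma addRight_mem_dihedral (c : Fin n) : Equiv.addRight c ∈ dihedral n := by
  have h1 : Equiv.addRight (1 : Fin n) ∈ dihedral n := Subgroup.subset_closure (by simp)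
  have h2 : ∀ (k : ℕ) (x : Fin n),
      (((Equiv.addRight (1 : Fin n)) ^ k) x).val = (x.val + k) % n := by
    intro k
    induction k with
    | zero => intro x; simp [Nat.mod_eq_of_lt x.isLt]
    | succ k ih =>
      intro x
      rw [pow_succ', Equiv.Perm.mul_apply, Equiv.coe_addRight, Fin.val_add, ih, Fin.val_one',
        ← Nat.add_mod, add_assoc]
  have h3 : Equiv.addRight c = (Equiv.addRight (1 : Fin n)) ^ c.val := by
    ext x
    rw [h2, Equiv.coe_addRight, Fin.val_add]
  rw [h3]
  exact pow_mem h1 _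

lemma mem_dihedral_iff {δ : Equiv.Perm (Fin n)} :
    δ ∈ dihedral n ↔ δ ∈ Set.range (dihedralPerm (n := n)) := by
  constructor
  · intro h
    induction h using Subgroup.closure_induction with
    | mem x hx =>
      rcases hx with rfl | rfl
      · exact ⟨(1, false), rfl⟩
      · exact ⟨(0, true), by ext; simp [dihedralPerm_apply]⟩
    | one => exact ⟨(0, false), by ext; simp [dihedralPerm_apply]⟩
    | mul x y _ _ hx hy =>
      obtain ⟨⟨c, b⟩, rfl⟩ := hx
      obtain ⟨⟨c', b'⟩, rfl⟩ := hy
      refine ⟨(if b then -c' + c else c' + c, xor b b'), ?_⟩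
      ext1 x
      rw [Equiv.Perm.mul_apply]
      simp only [dihedralPerm_apply]
      cases b <;> cases b' <;> simp <;> abel
    | inv x _ hx =>
      obtain ⟨⟨c, b⟩, rfl⟩ := hx
      refine ⟨(if b then c else -c, b), ?_⟩
      rw [eq_inv_iff_mul_eq_one]
      ext1 x
      rw [Equiv.Perm.mul_apply]
      simp only [dihedralPerm_apply]
      cases b <;> simp
  · rintro ⟨⟨c, b⟩, rfl⟩
    have h1 := addRight_mem_dihedral c
    cases b
    · exact h1
    · exact mul_mem h1 (Subgroup.subset_closure (by simp))

lemma card_dihedral (hn : 3 ≤ n) :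
    (Finset.univ.filter fun δ : Equiv.Perm (Fin n) => δ ∈ dihedral n).card = 2 * n := by
  have h : (Finset.univ.filter fun δ : Equiv.Perm (Fin n) => δ ∈ dihedral n) =
      Finset.univ.image dihedralPerm := by
    ext δ
    simp only [mem_dihedral_iff, Finset.mem_filter, Finset.mem_univ, true_and, Finset.mem_image,
      Set.mem_range]
  rw [h, Finset.card_image_of_injective _ (dihedralPerm_injective hn)]
  simp [mul_comm]

lemma sum_Msigma_eq_mul_sum_representatives (hn : 3 ≤ n) (s : Finset (Fin n) → ℝ)
    {R : Finset (Equiv.Perm (Fin n))}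
    (hR : ∀ σ : Equiv.Perm (Fin n),
      ∃! τ : Equiv.Perm (Fin n), τ ∈ R ∧ σ⁻¹ * τ ∈ dihedral n) :
    ∑ σ : Equiv.Perm (Fin n), Msigma s σ = 2 * n * ∑ τ ∈ R, Msigma s τ := by
  have h1 : ∀ σ : Equiv.Perm (Fin n),
      Msigma s σ = ∑ τ ∈ R, if σ⁻¹ * τ ∈ dihedral n then Msigma s τ else 0 := by
    intro σ
    obtain ⟨τ, ⟨hτ, hd⟩, huniq⟩ := hR σ
    rw [Finset.sum_eq_single_of_mem τ hτ, if_pos hd]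
    · rw [← Msigma_mul_dihedral hn s hd σ, mul_inv_cancel_left]
    · intro τ' hτ' hne
      exact if_neg fun hd' => hne (huniq τ' ⟨hτ', hd'⟩)
  rw [Finset.sum_congr rfl fun σ _ => h1 σ]
  rw [Finset.sum_comm, Finset.mul_sum]
  refine Finset.sum_congr rfl fun τ _ => ?_
  have h2 : (Finset.univ.filter fun σ : Equiv.Perm (Fin n) => σ⁻¹ * τ ∈ dihedral n).card =
      2 * n := by
    rw [← card_dihedral hn]
    refine Finset.card_bij (fun σ _ => σ⁻¹ * τ) (by simp) (by simp) fun δ hδ => ?_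
    exact ⟨τ * δ⁻¹, by simpa using hδ, by simp⟩
  rw [← Finset.sum_filter, Finset.sum_const, h2, nsmul_eq_mul]
  push_cast
  rfl

end Dihedral

/-- Theorem 5.3: the sum of `M_n(σ)` over all permutations is `n 2^{n-2}` times the
crossing-symmetric φ³ amplitude; hence summing over a set of coset representatives of the
dihedral subgroup gives `2^{n-3}` times the amplitude. -/
theorem crossing_symmetric_phi3_amplitude (n : ℕ) [NeZero n] (hn : 3 ≤ n)
    (s : Finset (Fin n) → ℝ) (hs : ∀ I : Finset (Fin n), IsSplit I → s I ≠ 0) :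
    (∑ σ : Equiv.Perm (Fin n), Msigma s σ) = (n : ℝ) * 2 ^ (n - 2) * Mamp s ∧
    ∀ R : Finset (Equiv.Perm (Fin n)),
      (∀ σ : Equiv.Perm (Fin n), ∃! τ : Equiv.Perm (Fin n), τ ∈ R ∧ σ⁻¹ * τ ∈ dihedral n) →
      (∑ σ ∈ R, Msigma s σ) = 2 ^ (n - 3) * Mamp s := by
  refine ⟨sum_Msigma hn s, fun R hR => ?_⟩
  have h := sum_Msigma_eq_mul_sum_representatives hn s hR
  rw [sum_Msigma hn s] at h
  obtain ⟨m, rfl⟩ : ∃ m, n = m + 3 := ⟨n - 3, by omega⟩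
  rw [show m + 3 - 2 = m + 1 by omega, pow_succ] at h
  rw [Nat.add_sub_cancel]
  have hpos : (2 * ((m + 3 : ℕ) : ℝ)) ≠ 0 := by positivity
  refine mul_left_cancel₀ hpos ?_
  rw [← h]
  ring
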